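/- arXiv:2309.01044 — 3 statements merged into one kernel-verified Lean document; each statement's English description precedes it below -/
import Mathlib

section
/- Let A be an abelian category and X a subcategory of A. The following are equivalent: (i) X is an IE-closed subcategory of A; (ii) X = T(X) ∩ F(X); (iii) X is a torsion-free class of T(X); (iv) X is a torsion class of F(X); (v) there exists a torsion class T of A such that X is a torsion-free class of T; (vi) there exists a torsion-free class F of A such that X is a torsion class of F. -/
/-!
Statement 2: For a subcategory `X` of an abelian category `A`, TFAE:
(i) `X` is IE-closed; (ii) `X = T(X) ∩ F(X)`; (iii) `X` is a torsion-free class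
of `T(X)`; (iv) `X` is a torsion class of `F(X)`; (v) there is a torsion class
`T` of `A` such that `X` is a torsion-free class of `T`; (vi) there is a
torsion-free class `F` of `A` such that `X` is a torsion class of `F`.
-/

open CategoryTheory CategoryTheory.Limits

universe v u

variable {A : Type u} [Category.{v} A] [Abelian A]

/-- An additive subcategory: contains the zero objects and is closed under
isomorphisms and finite direct sums. -/
def IsAdditiveSubcat (P : A → Prop) : Prop :=
  (∀ Z : A, IsZero Z → P Z) ∧
  (∀ X Y : A, (X ≅ Y) → P X → P Y) ∧
  (∀ X Y : A, P X → P Y → P (X ⊞ Y))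

/-- `P` is closed under extensions. -/
def ClosedUnderExtensions (P : A → Prop) : Prop :=
  ∀ S : CategoryTheory.ShortComplex A, S.ShortExact → P S.X₁ → P S.X₃ → P S.X₂

/-- `P` is closed under subobjects. -/
def ClosedUnderSubobjects (P : A → Prop) : Prop :=
  ∀ (X Y : A) (f : X ⟶ Y), Mono f → P Y → P X

/-- `P` is closed under quotient objects. -/
def ClosedUnderQuotients (P : A → Prop) : Prop :=
  ∀ (X Y : A) (f : X ⟶ Y), Epi f → P X → P Y

/-- `P` is closed under images of morphisms between its objects. -/
def ClosedUnderImages (P : A → Prop) : Prop :=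
  ∀ (X Y : A) (f : X ⟶ Y), P X → P Y → P (image f)

/-- A torsion-free class of `A`. -/
def IsTorsionFreeClass (P : A → Prop) : Prop :=
  IsAdditiveSubcat P ∧ ClosedUnderSubobjects P ∧ ClosedUnderExtensions P

/-- A torsion class of `A`. -/
def IsTorsionClass (P : A → Prop) : Prop :=
  IsAdditiveSubcat P ∧ ClosedUnderQuotients P ∧ ClosedUnderExtensions P

/-- An IE-closed subcategory of `A`: an additive subcategory closed under
images and extensions. -/
def IsIEClosed (P : A → Prop) : Prop :=
  IsAdditiveSubcat P ∧ ClosedUnderImages P ∧ ClosedUnderExtensions P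

/-- `S` is a torsion-free class of the extension-closed subcategory `C`. -/
def IsTorsionFreeClassOf (C S : A → Prop) : Prop :=
  (∀ X, S X → C X) ∧ IsAdditiveSubcat S ∧
  (∀ T : CategoryTheory.ShortComplex A, T.ShortExact → C T.X₁ → C T.X₂ → C T.X₃ →
    (S T.X₁ → S T.X₃ → S T.X₂)) ∧
  (∀ T : CategoryTheory.ShortComplex A, T.ShortExact → C T.X₁ → C T.X₂ → C T.X₃ →
    (S T.X₂ → S T.X₁))

/-- `S` is a torsion class of the extension-closed subcategory `C`. -/
def IsTorsionClassOf (C S : A → Prop) : Prop :=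
  (∀ X, S X → C X) ∧ IsAdditiveSubcat S ∧
  (∀ T : CategoryTheory.ShortComplex A, T.ShortExact → C T.X₁ → C T.X₂ → C T.X₃ →
    (S T.X₁ → S T.X₃ → S T.X₂)) ∧
  (∀ T : CategoryTheory.ShortComplex A, T.ShortExact → C T.X₁ → C T.X₂ → C T.X₃ →
    (S T.X₂ → S T.X₃))

/-- The torsion-free closure `F(X)`. -/
def torsionFreeClosure (P : A → Prop) : A → Prop :=
  fun M => ∀ F : A → Prop, IsTorsionFreeClass F → (∀ N, P N → F N) → F M

/-- The torsion closure `T(X)`. -/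
def torsionClosure (P : A → Prop) : A → Prop :=
  fun M => ∀ T : A → Prop, IsTorsionClass T → (∀ N, P N → T N) → T M

/-- The pushout of a short exact sequence along a morphism out of its left term. -/
theorem CategoryTheory.ShortComplex.ShortExact.pushout {S : ShortComplex A} (hS : S.ShortExact)
    {N : A} (p : S.X₁ ⟶ N) :
    (ShortComplex.mk (pushout.inl p S.f) (pushout.desc 0 S.g (by rw [comp_zero, S.zero]))
      (pushout.inl_desc _ _ _)).ShortExact := by
  have := hS.mono_f
  have := hS.epi_g
  have hg : pushout.inr p S.f ≫ pushout.desc 0 S.g (by rw [comp_zero, S.zero]) = S.g :=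
    pushout.inr_desc _ _ _
  have : Epi (pushout.desc 0 S.g (by rw [comp_zero, S.zero]) : Limits.pushout p S.f ⟶ S.X₃) :=
    epi_of_epi_fac hg
  have key {Z : A} (a : Limits.pushout p S.f ⟶ Z) (ha : pushout.inl p S.f ≫ a = 0) :
      ∃ b, pushout.desc 0 S.g (by rw [comp_zero, S.zero]) ≫ b = a := by
    obtain ⟨b, hb⟩ := CokernelCofork.IsColimit.desc' hS.gIsCokernel (pushout.inr p S.f ≫ a)
      (by rw [← pushout.condition_assoc, ha, comp_zero])
    refine ⟨b, pushout.hom_ext ?_ ?_⟩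
    · rw [pushout.inl_desc_assoc, zero_comp, ha]
    · rw [pushout.inr_desc_assoc]
      exact hb
  refine { exact := ShortComplex.exact_of_g_is_cokernel _ ?_ }
  exact CokernelCofork.IsColimit.ofπ _ _ (fun a ha => (key a ha).choose)
    (fun a ha => (key a ha).choose_spec)
    (fun a ha b hb => (cancel_epi _).1 (hb.trans (key a ha).choose_spec.symm))

/-- Pushing out a short exact sequence along the cokernel of `k` quotients its middle term
by the source of `k`. -/
theorem CategoryTheory.ShortComplex.ShortExact.pushout_cokernel {S : ShortComplex A}
    (hS : S.ShortExact) {K : A} (k : K ⟶ S.X₁) [Mono k] :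
    (ShortComplex.mk (k ≫ S.f) (pushout.inr (cokernel.π k) S.f)
      (by rw [Category.assoc, ← pushout.condition, cokernel.condition_assoc,
        zero_comp])).ShortExact := by
  have := hS.mono_f
  refine { exact := ShortComplex.exact_of_g_is_cokernel _ ?_, mono_f := mono_comp k S.f }
  refine CokernelCofork.IsColimit.ofπ _ _
    (fun a ha => pushout.desc (cokernel.desc k (S.f ≫ a) (by simpa using ha)) a (by simp))
    (fun a ha => pushout.inr_desc _ _ _) (fun a ha b hb => ?_)
  exact (cancel_epi _).1 (hb.trans (pushout.inr_desc _ _ _).symm)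

/-- If `T` is closed under quotients, `X` is extension-closed and every object of `T` that embeds
into an object of `X` lies in `X`, then some class `D ⊇ X` closed under subobjects and extensions
satisfies `T ∩ D ⊆ X`. -/
theorem exists_subobject_closed_class {T X : A → Prop} (hT : ClosedUnderQuotients T)
    (hX : ClosedUnderExtensions X) (hX0 : ∀ Z, IsZero Z → X Z)
    (hTX : ∀ (M N : A) (f : M ⟶ N), Mono f → T M → X N → X M) :
    ∃ D : A → Prop, ClosedUnderSubobjects D ∧ ClosedUnderExtensions D ∧
      (∀ M, X M → D M) ∧ ∀ M, T M → D M → X M := by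
  refine ⟨fun M => ∀ S : ShortComplex A, S.ShortExact → (∃ i : S.X₁ ⟶ M, Mono i) →
    T S.X₂ → X S.X₃ → X S.X₂, ?_, ?_, ?_, ?_⟩
  · rintro M N f hf hN S hS ⟨i, hi⟩
    exact hN S hS ⟨i ≫ f, mono_comp i f⟩
  · rintro R hR h₁ h₃ S hS ⟨i, hi⟩ hT₂ hX₃
    have := hR.mono_f
    have hlift : (kernel.ι (i ≫ R.g) ≫ i) ≫ R.g = 0 := by simp
    have : Mono (hR.exact.lift _ hlift) := mono_of_mono_fac (hR.exact.lift_f _ hlift)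
    have hE := h₁ _ (hS.pushout_cokernel (kernel.ι (i ≫ R.g)))
      ⟨hR.exact.lift _ hlift, inferInstance⟩ hT₂
    refine hE (h₃ (ShortComplex.mk _ _ _) (hS.pushout _)
      ⟨Abelian.factorThruCoimage (i ≫ R.g), inferInstance⟩ ?_ hX₃)
    exact hT _ _ (pushout.inr _ S.f) inferInstance hT₂
  · rintro M hM S hS ⟨i, hi⟩ hT₂ hX₃
    exact hTX _ _ (pushout.inr i S.f) inferInstance hT₂ (hX _ (hS.pushout i) hM hX₃)
  · intro M hTM hM
    refine hM (ShortComplex.mk (𝟙 M) (0 : M ⟶ (⊥_ A)) comp_zero) ?_ ⟨𝟙 M, inferInstance⟩ hTM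
      (hX0 _ initialIsInitial.isZero)
    exact { exact := (ShortComplex.exact_iff_epi _ rfl).2 (inferInstanceAs (Epi (𝟙 M)))
            mono_f := inferInstanceAs (Mono (𝟙 M))
            epi_g := inferInstance }

/-- The dual of `exists_subobject_closed_class`. -/
theorem exists_quotient_closed_class {F X : A → Prop} (hF : ClosedUnderSubobjects F)
    (hX : ClosedUnderExtensions X) (hX0 : ∀ Z, IsZero Z → X Z)
    (hFX : ∀ (M N : A) (f : M ⟶ N), Epi f → X M → F N → X N) :
    ∃ D : A → Prop, ClosedUnderQuotients D ∧ ClosedUnderExtensions D ∧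
      (∀ M, X M → D M) ∧ ∀ M, F M → D M → X M := by
  obtain ⟨D, hsub, hext, hXD, hD⟩ := exists_subobject_closed_class (A := Aᵒᵖ)
    (T := fun M => F M.unop) (X := fun M => X M.unop)
    (fun M N f _ hM => hF _ _ f.unop inferInstance hM)
    (fun S hS h₁ h₃ => hX _ hS.unop h₃ h₁)
    (fun Z hZ => hX0 _ hZ.unop)
    (fun M N f _ hM hN => hFX _ _ f.unop inferInstance hN hM)
  exact ⟨fun M => D (Opposite.op M), fun M N f _ hM => hsub _ _ f.op inferInstance hM,
    fun S hS h₁ h₃ => hext _ hS.op h₃ h₁, fun M => hXD (Opposite.op M),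
    fun M => hD (Opposite.op M)⟩

theorem isAdditiveSubcat_of_closedUnderExtensions {P : A → Prop} (h0 : ∀ Z, IsZero Z → P Z)
    (hiso : ∀ X Y : A, (X ≅ Y) → P X → P Y) (hext : ClosedUnderExtensions P) :
    IsAdditiveSubcat P :=
  ⟨h0, hiso, fun X Y hX hY => hext
    (ShortComplex.mk (biprod.inl : X ⟶ X ⊞ Y) biprod.snd biprod.inl_snd)
    (ShortComplex.Splitting.ofHasBinaryBiproduct X Y).shortExact hX hY⟩

theorem isTorsionFreeClass_torsionFreeClosure (X : A → Prop) :
    IsTorsionFreeClass (torsionFreeClosure X) := by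
  refine ⟨⟨fun Z hZ F hF _ => hF.1.1 Z hZ, fun M N e hM F hF h => hF.1.2.1 M N e (hM F hF h),
    fun M N hM hN F hF h => hF.1.2.2 M N (hM F hF h) (hN F hF h)⟩, ?_, ?_⟩
  · exact fun M N f hf hN F hF h => hF.2.1 M N f hf (hN F hF h)
  · exact fun S hS h₁ h₃ F hF h => hF.2.2 S hS (h₁ F hF h) (h₃ F hF h)

theorem isTorsionClass_torsionClosure (X : A → Prop) :
    IsTorsionClass (torsionClosure X) := by
  refine ⟨⟨fun Z hZ F hF _ => hF.1.1 Z hZ, fun M N e hM F hF h => hF.1.2.1 M N e (hM F hF h),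
    fun M N hM hN F hF h => hF.1.2.2 M N (hM F hF h) (hN F hF h)⟩, ?_, ?_⟩
  · exact fun M N f hf hN F hF h => hF.2.1 M N f hf (hN F hF h)
  · exact fun S hS h₁ h₃ F hF h => hF.2.2 S hS (h₁ F hF h) (h₃ F hF h)

theorem torsionClosure_of_mem {X : A → Prop} {M : A} (hM : X M) : torsionClosure X M :=
  fun _ _ h => h M hM

theorem torsionFreeClosure_of_mem {X : A → Prop} {M : A} (hM : X M) : torsionFreeClosure X M :=
  fun _ _ h => h M hM

theorem IsIEClosed.of_torsionClosure_of_mono {X : A → Prop} (hX : IsIEClosed X) {M N : A}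
    (f : M ⟶ N) [Mono f] (hM : torsionClosure X M) (hN : X N) : X M := by
  obtain ⟨⟨hX0, hiso, -⟩, him, hext⟩ := hX
  obtain ⟨D, hquot, hDext, hXD, hD⟩ := exists_quotient_closed_class
    (F := fun M => ∃ N, X N ∧ ∃ f : M ⟶ N, Mono f)
    (fun M N f _ ⟨Y, hY, g, _⟩ => ⟨Y, hY, f ≫ g, mono_comp f g⟩) hext hX0
    (by
      rintro M N f hf hM ⟨Y, hY, g, hg⟩
      have := strongEpi_of_epi f
      exact hiso _ _ (image.isoStrongEpiMono f g rfl).symm (him _ _ (f ≫ g) hM hY))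
  refine hD M ⟨N, hN, f, inferInstance⟩ (hM D ⟨?_, hquot, hDext⟩ hXD)
  exact isAdditiveSubcat_of_closedUnderExtensions (fun Z hZ => hXD Z (hX0 Z hZ))
    (fun M N e hM => hquot M N e.hom inferInstance hM) hDext

theorem IsIEClosed.of_torsionClosure_of_torsionFreeClosure {X : A → Prop} (hX : IsIEClosed X)
    {M : A} (hT : torsionClosure X M) (hF : torsionFreeClosure X M) : X M := by
  obtain ⟨D, hsub, hDext, hXD, hD⟩ := exists_subobject_closed_class
    (isTorsionClass_torsionClosure X).2.1 hX.2.2 hX.1.1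
    (fun M N f _ hM hN => hX.of_torsionClosure_of_mono f hM hN)
  refine hD M hT (hF D ⟨?_, hsub, hDext⟩ hXD)
  exact isAdditiveSubcat_of_closedUnderExtensions (fun Z hZ => hXD Z (hX.1.1 Z hZ))
    (fun M N e hM => hsub N M e.inv inferInstance hM) hDext

theorem IsTorsionFreeClassOf.isIEClosed {T X : A → Prop} (hX : IsTorsionFreeClassOf T X)
    (hT : IsTorsionClass T) : IsIEClosed X := by
  obtain ⟨hXT, hadd, hext, hsub⟩ := hX
  refine ⟨hadd, fun M N f hM hN => ?_, fun S hS h₁ h₃ =>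
    hext S hS (hXT _ h₁) (hT.2.2 S hS (hXT _ h₁) (hXT _ h₃)) (hXT _ h₃) h₁ h₃⟩
  refine hsub (ShortComplex.mk (image.ι f) (cokernel.π (image.ι f)) (cokernel.condition _))
    { exact := ShortComplex.exact_cokernel _ } ?_ (hXT _ hN) ?_ hN
  · exact hT.2.1 _ _ (factorThruImage f) inferInstance (hXT _ hM)
  · exact hT.2.1 _ _ (cokernel.π (image.ι f)) inferInstance (hXT _ hN)

theorem IsTorsionClassOf.isIEClosed {F X : A → Prop} (hX : IsTorsionClassOf F X)
    (hF : IsTorsionFreeClass F) : IsIEClosed X := by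
  obtain ⟨hXF, hadd, hext, hquot⟩ := hX
  refine ⟨hadd, fun M N f hM hN => ?_, fun S hS h₁ h₃ =>
    hext S hS (hXF _ h₁) (hF.2.2 S hS (hXF _ h₁) (hXF _ h₃)) (hXF _ h₃) h₁ h₃⟩
  refine hquot (ShortComplex.mk (kernel.ι (factorThruImage f)) (factorThruImage f)
    (kernel.condition _)) { exact := ShortComplex.exact_kernel _ } ?_ (hXF _ hM) ?_ hM
  · exact hF.2.1 _ _ (kernel.ι (factorThruImage f)) inferInstance (hXF _ hM)
  · exact hF.2.1 _ _ (image.ι f) inferInstance (hXF _ hN)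

theorem IsTorsionClass.isIEClosed_inter {T F : A → Prop} (hT : IsTorsionClass T)
    (hF : IsTorsionFreeClass F) : IsIEClosed fun M => T M ∧ F M := by
  refine ⟨⟨fun Z hZ => ⟨hT.1.1 Z hZ, hF.1.1 Z hZ⟩,
    fun M N e hM => ⟨hT.1.2.1 M N e hM.1, hF.1.2.1 M N e hM.2⟩,
    fun M N hM hN => ⟨hT.1.2.2 M N hM.1 hN.1, hF.1.2.2 M N hM.2 hN.2⟩⟩, ?_, ?_⟩
  · exact fun M N f hM hN => ⟨hT.2.1 _ _ (factorThruImage f) inferInstance hM.1,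
      hF.2.1 _ _ (image.ι f) inferInstance hN.2⟩
  · exact fun S hS h₁ h₃ => ⟨hT.2.2 S hS h₁.1 h₃.1, hF.2.2 S hS h₁.2 h₃.2⟩

theorem IE_closed_tfae (X : A → Prop) :
    List.TFAE
      [ IsIEClosed X,
        ∀ M : A, X M ↔ (torsionClosure X M ∧ torsionFreeClosure X M),
        IsTorsionFreeClassOf (torsionClosure X) X,
        IsTorsionClassOf (torsionFreeClosure X) X,
        ∃ T : A → Prop, IsTorsionClass T ∧ IsTorsionFreeClassOf T X,
        ∃ F : A → Prop, IsTorsionFreeClass F ∧ IsTorsionClassOf F X ] := by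
  have hT := isTorsionClass_torsionClosure X
  have hF := isTorsionFreeClass_torsionFreeClosure X
  tfae_have 1 → 2 := fun h M =>
    ⟨fun hM => ⟨torsionClosure_of_mem hM, torsionFreeClosure_of_mem hM⟩,
      fun hM => h.of_torsionClosure_of_torsionFreeClosure hM.1 hM.2⟩
  tfae_have 1 → 3 := fun h =>
    ⟨fun _ => torsionClosure_of_mem, h.1, fun S hS _ _ _ => h.2.2 S hS,
      fun S hS h₁ _ _ hX => h.of_torsionClosure_of_torsionFreeClosure h₁
        (hF.2.1 _ _ S.f hS.mono_f (torsionFreeClosure_of_mem hX))⟩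
  tfae_have 1 → 4 := fun h =>
    ⟨fun _ => torsionFreeClosure_of_mem, h.1, fun S hS _ _ _ => h.2.2 S hS,
      fun S hS _ _ h₃ hX => h.of_torsionClosure_of_torsionFreeClosure
        (hT.2.1 _ _ S.g hS.epi_g (torsionClosure_of_mem hX)) h₃⟩
  tfae_have 2 → 1 := fun h => by
    rw [funext fun M => propext (h M)]
    exact hT.isIEClosed_inter hF
  tfae_have 3 → 5 := fun h => ⟨_, hT, h⟩
  tfae_have 4 → 6 := fun h => ⟨_, hF, h⟩
  tfae_have 5 → 1 := fun ⟨_, hT', h⟩ => h.isIEClosed hT'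
  tfae_have 6 → 1 := fun ⟨_, hF', h⟩ => h.isIEClosed hF'
  tfae_finish
end

section
/- Let R be a commutative noetherian ring of finite Krull dimension, and let p be a prime ideal of R with height(p) ≥ dim R − 1. Then every KE-closed subcategory X of mod R with Ass X = {p} equals mod^ass_{p} R, the subcategory of finitely generated R-modules M with Ass M ⊆ {p}. -/
/-! Statement 10: Let `R` be a commutative noetherian ring of finite Krull
dimension and `p` a prime ideal with `height p ≥ dim R - 1` (equivalently
`dim R ≤ height p + 1`). Then every KE-closed subcategory `X` of `mod R` with
`Ass X = {p}` equals `mod^ass_{p} R`. -/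

open CategoryTheory

universe u

section Defs

variable (R : Type u) [CommRing R]

/-- `P` is a class of finitely generated `R`-modules (a subcategory of
`mod R`). -/
def IsSubcatOfFGMod (P : ModuleCat.{u} R → Prop) : Prop :=
  ∀ M : ModuleCat.{u} R, P M → Module.Finite R M

/-- `P` is an additive subcategory: it contains the zero modules and is
closed under isomorphisms and finite direct sums. -/
def MIsAdditive (P : ModuleCat.{u} R → Prop) : Prop :=
  (∀ M : ModuleCat.{u} R, Subsingleton M → P M) ∧
  (∀ M N : ModuleCat.{u} R, (M ≃ₗ[R] N) → P M → P N) ∧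
  (∀ M N : ModuleCat.{u} R, P M → P N → P (ModuleCat.of R (M × N)))

/-- `P` is closed under submodules. -/
def MClosedUnderSubmodules (P : ModuleCat.{u} R → Prop) : Prop :=
  ∀ (M : ModuleCat.{u} R) (N : Submodule R M), P M → P (ModuleCat.of R N)

/-- `P` is closed under kernels of `R`-linear maps between its members. -/
def MClosedUnderKernels (P : ModuleCat.{u} R → Prop) : Prop :=
  ∀ (M N : ModuleCat.{u} R) (f : M →ₗ[R] N), P M → P N →
    P (ModuleCat.of R (LinearMap.ker f))

/-- `P` is closed under extensions: for every short exact sequence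
`0 → N → M → M/N → 0`, if the two outer terms lie in `P` then so does `M`.
(Together with closure under isomorphisms this is equivalent to the usual
formulation with arbitrary short exact sequences.) -/
def MClosedUnderExtensions (P : ModuleCat.{u} R → Prop) : Prop :=
  ∀ (M : ModuleCat.{u} R) (N : Submodule R M),
    P (ModuleCat.of R N) → P (ModuleCat.of R (M ⧸ N)) → P M

/-- `P` is a torsion-free class of `mod R`: an additive subcategory of
finitely generated modules closed under submodules and extensions. -/
def MIsTorsionFreeClass (P : ModuleCat.{u} R → Prop) : Prop :=
  IsSubcatOfFGMod R P ∧ MIsAdditive R P ∧ MClosedUnderSubmodules R P ∧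
    MClosedUnderExtensions R P

/-- `P` is a KE-closed subcategory of `mod R`: an additive subcategory of
finitely generated modules closed under kernels and extensions. -/
def MIsKEClosed (P : ModuleCat.{u} R → Prop) : Prop :=
  IsSubcatOfFGMod R P ∧ MIsAdditive R P ∧ MClosedUnderKernels R P ∧
    MClosedUnderExtensions R P

/-- `Ass X`: the union of the associated primes of members of `X`. -/
def AssOf (P : ModuleCat.{u} R → Prop) : Set (Ideal R) :=
  {p | ∃ M : ModuleCat.{u} R, P M ∧ p ∈ associatedPrimes R M}

/-- `mod^ass_Φ R`: the finitely generated modules all of whose associated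
primes lie in `Φ`. -/
def modAss (Φ : Set (Ideal R)) : ModuleCat.{u} R → Prop :=
  fun M => Module.Finite R M ∧ associatedPrimes R M ⊆ Φ

end Defs

section KEClosed

variable {R : Type u} [CommRing R] {P : ModuleCat.{u} R → Prop}

lemma MIsAdditive.of_equiv (hP : MIsAdditive R P) {A B : Type u} [AddCommGroup A] [Module R A]
    [AddCommGroup B] [Module R B] (e : A ≃ₗ[R] B) (hA : P (ModuleCat.of R A)) :
    P (ModuleCat.of R B) :=
  hP.2.1 (ModuleCat.of R A) (ModuleCat.of R B) e hA

lemma MIsKEClosed.ker (hP : MIsKEClosed R P) {A B : Type u} [AddCommGroup A] [Module R A]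
    [AddCommGroup B] [Module R B] (f : A →ₗ[R] B) (hA : P (ModuleCat.of R A))
    (hB : P (ModuleCat.of R B)) : P (ModuleCat.of R (LinearMap.ker f)) :=
  hP.2.2.1 (ModuleCat.of R A) (ModuleCat.of R B) f hA hB

lemma MIsKEClosed.of_surjective (hP : MIsKEClosed R P) {A B : Type u} [AddCommGroup A]
    [Module R A] [AddCommGroup B] [Module R B] (f : A →ₗ[R] B) (hf : Function.Surjective f)
    (hker : P (ModuleCat.of R (LinearMap.ker f))) (hB : P (ModuleCat.of R B)) :
    P (ModuleCat.of R A) :=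
  hP.2.2.2 (ModuleCat.of R A) (LinearMap.ker f) hker
    (hP.2.1.of_equiv (f.quotKerEquivOfSurjective hf).symm hB)

/-- The fibre product of `g` and `π` is an extension of `B` by `ker g`, and `ker π` is the kernel of
its projection onto the first factor. -/
lemma MIsKEClosed.ker_of_range_le (hP : MIsKEClosed R P) {B Q : Type u} [AddCommGroup B]
    [Module R B] [AddCommGroup Q] [Module R Q] (g π : B →ₗ[R] Q)
    (hrange : LinearMap.range π ≤ LinearMap.range g) (hB : P (ModuleCat.of R B))
    (hg : P (ModuleCat.of R (LinearMap.ker g))) : P (ModuleCat.of R (LinearMap.ker π)) := by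
  let E : Submodule R (B × B) :=
    LinearMap.ker (g ∘ₗ LinearMap.fst R B B - π ∘ₗ LinearMap.snd R B B)
  have mem_E (z : B × B) : z ∈ E ↔ g z.1 = π z.2 := by
    simp [E, sub_eq_zero]
  let fstE : E →ₗ[R] B := LinearMap.fst R B B ∘ₗ E.subtype
  let sndE : E →ₗ[R] B := LinearMap.snd R B B ∘ₗ E.subtype
  have hsurj : Function.Surjective sndE := fun b ↦ by
    obtain ⟨a, ha⟩ := hrange ⟨b, rfl⟩
    exact ⟨⟨(a, b), (mem_E _).2 ha⟩, rfl⟩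
  have snd_zero (z : LinearMap.ker sndE) : z.1.1.2 = 0 := z.2
  have fst_zero (z : LinearMap.ker fstE) : z.1.1.1 = 0 := z.2
  let e₁ : LinearMap.ker sndE ≃ₗ[R] LinearMap.ker g :=
    { toFun := fun z ↦ ⟨z.1.1.1, by
        have h := (mem_E _).1 z.1.2
        rwa [snd_zero, map_zero] at h⟩
      map_add' := fun _ _ ↦ rfl
      map_smul' := fun _ _ ↦ rfl
      invFun := fun b ↦ ⟨⟨(b.1, 0), (mem_E _).2 (by simp)⟩, rfl⟩
      left_inv := fun z ↦ by
        ext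
        · rfl
        · exact (snd_zero z).symm
      right_inv := fun _ ↦ rfl }
  let e₂ : LinearMap.ker fstE ≃ₗ[R] LinearMap.ker π :=
    { toFun := fun z ↦ ⟨z.1.1.2, by
        have h := (mem_E _).1 z.1.2
        rw [fst_zero, map_zero] at h
        exact h.symm⟩
      map_add' := fun _ _ ↦ rfl
      map_smul' := fun _ _ ↦ rfl
      invFun := fun b ↦ ⟨⟨(0, b.1), (mem_E _).2 (by simp)⟩, rfl⟩
      left_inv := fun z ↦ by
        ext
        · exact (fst_zero z).symm
        · rfl
      right_inv := fun _ ↦ rfl }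
  have hE : P (ModuleCat.of R E) :=
    hP.of_surjective sndE hsurj (hP.2.1.of_equiv e₁.symm hg) hB
  exact hP.2.1.of_equiv e₂ (hP.ker fstE hE hB)

end KEClosed

section AssociatedPrimes

variable {R : Type u} [CommRing R] [IsNoetherianRing R] {p : Ideal R}
  {M : Type u} [AddCommGroup M] [Module R M]

lemma le_of_annihilator_le_of_associatedPrimes_subset [Module.Finite R M]
    (hM : associatedPrimes R M ⊆ {p}) {q : Ideal R} [q.IsPrime]
    (hq : Module.annihilator R M ≤ q) : p ≤ q := by
  obtain ⟨r, hr, hrq⟩ := Ideal.exists_minimalPrimes_le hq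
  have h := hM (Module.associatedPrimes.minimalPrimes_annihilator_subset_associatedPrimes R M hr)
  rwa [← Set.mem_singleton_iff.1 h]

lemma isSMulRegular_of_associatedPrimes_subset (hM : associatedPrimes R M ⊆ {p}) {x : R}
    (hx : x ∉ p) : IsSMulRegular M x := by
  by_contra h
  have hmem : x ∈ ⋃ q ∈ associatedPrimes R M, (q : Set R) := by
    rw [biUnion_associatedPrimes_eq_compl_regular]
    exact h
  obtain ⟨q, hq, hxq⟩ := Set.mem_iUnion₂.1 hmem
  exact hx (Set.mem_singleton_iff.1 (hM hq) ▸ hxq)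

lemma exists_injective_of_mem_associatedPrimes (h : p ∈ associatedPrimes R M) :
    ∃ f : (R ⧸ p) →ₗ[R] M, Function.Injective f := by
  obtain ⟨-, x, hx⟩ := isAssociatedPrime_iff_exists_injective_linearMap p M |>.1 h
  exact ⟨x, hx⟩

lemma annihilator_le_of_quotient_equiv {R : Type u} [CommRing R] {M : Type u} [AddCommGroup M]
    [Module R M] (N : Submodule R M) {q : Ideal R} (e : (M ⧸ N) ≃ₗ[R] R ⧸ q) :
    Module.annihilator R M ≤ q := by
  have h := (e.toLinearMap ∘ₗ N.mkQ).annihilator_le_of_surjective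
    (e.surjective.comp N.mkQ_surjective)
  rwa [Ideal.annihilator_quotient] at h

lemma Submodule.exists_lt_isQuotientEquivQuotientPrime (N : Submodule R M) (hN : N ≠ ⊤) :
    ∃ N', N < N' ∧ N.IsQuotientEquivQuotientPrime N' := by
  have := Submodule.Quotient.nontrivial_iff.mpr hN
  obtain ⟨q, hq⟩ := associatedPrimes.nonempty R (M ⧸ N)
  rw [AssociatedPrimes.mem_iff, isAssociatedPrime_iff] at hq
  obtain ⟨hq, x, rfl⟩ := hq
  obtain ⟨x, rfl⟩ := N.mkQ_surjective x
  have hxN : x ∉ N := fun h ↦ hq.ne_top (by rw [show N.mkQ x = 0 by simpa]; simp)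
  exact ⟨N ⊔ Submodule.span R {x}, by simpa using hxN,
    Submodule.isQuotientEquivQuotientPrime_iff.mpr ⟨x, hq, rfl⟩⟩

/-- If every prime strictly above `p` is maximal, then each maximal `q > p` is associated to
`M ⧸ xM` for `x ∈ q \ p`. -/
lemma mem_associatedPrimes_quotSMulTop [Module.Finite R M]
    (hM : associatedPrimes R M ⊆ {p}) (hp : ∀ q : Ideal R, q.IsPrime → p < q → q.IsMaximal)
    {q : Ideal R} [hq : q.IsPrime] (hMq : Module.annihilator R M ≤ q) {x : R} (hxq : x ∈ q)
    (hxp : x ∉ p) : q ∈ associatedPrimes R (QuotSMulTop x M) := by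
  have hsupp : (⟨q, hq⟩ : PrimeSpectrum R) ∈ Module.support R (QuotSMulTop x M) := by
    rw [Module.support_quotSMulTop]
    exact ⟨Module.mem_support_iff_of_finite.2 hMq, by simpa using hxq⟩
  have hann : Module.annihilator R (QuotSMulTop x M) ≤ q :=
    Module.mem_support_iff_of_finite.1 hsupp
  apply Module.associatedPrimes.minimalPrimes_annihilator_subset_associatedPrimes
  refine ⟨⟨hq, hann⟩, fun r hr hrq ↦ ?_⟩
  have := hr.1
  have hsupp' : (⟨r, hr.1⟩ : PrimeSpectrum R) ∈ Module.support R (QuotSMulTop x M) :=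
    Module.mem_support_iff_of_finite.2 hr.2
  rw [Module.support_quotSMulTop] at hsupp'
  have hxr : x ∈ r := by simpa using hsupp'.2
  have hpr : p ≤ r := le_of_annihilator_le_of_associatedPrimes_subset hM
    (Module.mem_support_iff_of_finite.1 hsupp'.1)
  have hmax := hp r hr.1 (lt_of_le_of_ne hpr fun h ↦ hxp (h ▸ hxr))
  exact (hmax.eq_of_le hq.ne_top hrq).ge

end AssociatedPrimes

section TorsionFree

variable {R : Type u} [CommRing R] [IsNoetherianRing R] {P : ModuleCat.{u} R → Prop} {p : Ideal R}

open scoped Pointwise in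
lemma MIsKEClosed.submodule_of_quotient_prime (hP : MIsKEClosed R P)
    (hmax : ∀ q : Ideal R, q.IsPrime → p < q → q.IsMaximal) {B : Type u} [AddCommGroup B]
    [Module R B] [Module.Finite R B] (hAss : associatedPrimes R B ⊆ {p})
    (hB : P (ModuleCat.of R B)) (N : Submodule R B) (q : Ideal R) [hq : q.IsPrime]
    (e : (B ⧸ N) ≃ₗ[R] R ⧸ q) : P (ModuleCat.of R N) := by
  have hann : Module.annihilator R B ≤ q := annihilator_le_of_quotient_equiv N e
  have hpq : p ≤ q := le_of_annihilator_le_of_associatedPrimes_subset hAss hann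
  have hker {C : Type u} [AddCommGroup C] [Module R C] (ι : (R ⧸ q) →ₗ[R] C)
      (hι : Function.Injective ι) : LinearMap.ker (ι ∘ₗ e.toLinearMap ∘ₗ N.mkQ) = N := by
    ext b
    simp [map_eq_zero_iff ι hι]
  rcases hpq.eq_or_lt with rfl | hlt
  · have : Nontrivial (B ⧸ N) := e.toEquiv.nontrivial
    have : Nontrivial B := N.mkQ_surjective.nontrivial
    obtain ⟨r, hr⟩ := associatedPrimes.nonempty R B
    obtain ⟨ι, hι⟩ := exists_injective_of_mem_associatedPrimes
      (Set.mem_singleton_iff.1 (hAss hr) ▸ hr)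
    rw [← hker ι hι]
    exact hP.ker _ hB hB
  · obtain ⟨x, hxq, hxp⟩ := SetLike.exists_of_lt hlt
    obtain ⟨ι, hι⟩ := exists_injective_of_mem_associatedPrimes
      (mem_associatedPrimes_quotSMulTop hAss hmax hann hxq hxp)
    have hreg := isSMulRegular_of_associatedPrimes_subset hAss hxp
    have hx : P (ModuleCat.of R (x • (⊤ : Submodule R B) : Submodule R B)) := by
      have h : LinearMap.range (LinearMap.lsmul R B x) = x • (⊤ : Submodule R B) := by
        rw [LinearMap.range_eq_map]
        rfl
      rw [← h]
      exact hP.2.1.of_equiv (LinearEquiv.ofInjective (LinearMap.lsmul R B x) hreg) hB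
    rw [← hker ι hι]
    refine hP.ker_of_range_le (x • (⊤ : Submodule R B)).mkQ _ ?_ hB ?_
    · rw [Submodule.range_mkQ]
      exact le_top
    · rwa [Submodule.ker_mkQ]

lemma MIsKEClosed.submodule (hP : MIsKEClosed R P)
    (hmax : ∀ q : Ideal R, q.IsPrime → p < q → q.IsMaximal) {B : Type u} [AddCommGroup B]
    [Module R B] [Module.Finite R B] (hAss : associatedPrimes R B ⊆ {p})
    (hB : P (ModuleCat.of R B)) (N : Submodule R B) : P (ModuleCat.of R N) := by
  induction N using WellFoundedGT.induction with
  | ind N ih =>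
    by_cases hN : N = ⊤
    · subst hN
      exact hP.2.1.of_equiv Submodule.topEquiv.symm hB
    obtain ⟨N', hlt, hle, q, ⟨e⟩⟩ := N.exists_lt_isQuotientEquivQuotientPrime hN
    have hq := q.2
    exact hP.2.1.of_equiv (Submodule.submoduleOfEquivOfLe hle)
      (hP.submodule_of_quotient_prime hmax
        ((associatedPrimes.subset_of_injective (Submodule.subtype_injective _)).trans hAss)
        (ih _ hlt) _ q.1 e)

lemma MIsKEClosed.of_associatedPrimes_subset (hP : MIsKEClosed R P)
    (hmax : ∀ q : Ideal R, q.IsPrime → p < q → q.IsMaximal)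
    (hAss : ∀ B : ModuleCat.{u} R, P B → associatedPrimes R B ⊆ {p})
    (hp : P (ModuleCat.of R (R ⧸ p))) {M : Type u} [AddCommGroup M] [Module R M]
    [Module.Finite R M] (hM : associatedPrimes R M ⊆ {p}) : P (ModuleCat.of R M) := by
  refine hP.2.1.of_equiv Submodule.topEquiv (WellFoundedGT.induction_top
    (P := fun N : Submodule R M ↦ P (ModuleCat.of R N)) ⟨⊥, hP.2.1.1 _ ?_⟩ fun N hN hPN ↦ ?_)
  · exact inferInstanceAs (Subsingleton (⊥ : Submodule R M))
  obtain ⟨N', hlt, -, q, ⟨e⟩⟩ := N.exists_lt_isQuotientEquivQuotientPrime hN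
  refine ⟨N', hlt, ?_⟩
  have hN' : associatedPrimes R N' ⊆ {p} :=
    (associatedPrimes.subset_of_injective N'.subtype_injective).trans hM
  have hpq : p ≤ q.1 := le_of_annihilator_le_of_associatedPrimes_subset hN'
    (annihilator_le_of_quotient_equiv _ e)
  rcases hpq.eq_or_lt with rfl | hpq
  · refine hP.of_surjective (e.toLinearMap ∘ₗ (N.submoduleOf N').mkQ)
      (e.surjective.comp (Submodule.mkQ_surjective _)) ?_ hp
    rw [LinearEquiv.ker_comp, Submodule.ker_mkQ]
    exact hP.2.1.of_equiv (Submodule.submoduleOfEquivOfLe hlt.le).symm hPN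
  · obtain ⟨d, hdq, hdp⟩ := SetLike.exists_of_lt hpq
    have hd (y : N') : d • (y : M) ∈ N := by
      have h : e ((N.submoduleOf N').mkQ (d • y)) = 0 := by
        obtain ⟨a, ha⟩ := Ideal.Quotient.mk_surjective (e ((N.submoduleOf N').mkQ y))
        rw [map_smul, map_smul, ← ha]
        exact Ideal.Quotient.eq_zero_iff_mem.2 (q.1.mul_mem_right a hdq)
      exact (Submodule.Quotient.mk_eq_zero (N.submoduleOf N')).1 (e.map_eq_zero_iff.1 h)
    let f : N' →ₗ[R] N := (LinearMap.lsmul R M d ∘ₗ N'.subtype).codRestrict N hd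
    have hf : Function.Injective f := fun y z h ↦ Subtype.ext <|
      isSMulRegular_of_associatedPrimes_subset hM hdp (congrArg Subtype.val h)
    exact hP.2.1.of_equiv (LinearEquiv.ofInjective f hf).symm
      (hP.submodule hmax (hAss _ hPN) hPN (LinearMap.range f))

end TorsionFree

lemma isMaximal_of_ringKrullDim_le_height_add_one {R : Type u} [CommRing R]
    (hfin : ringKrullDim R ≠ ⊤) {p : PrimeSpectrum R}
    (hht : ringKrullDim R ≤ ((Order.height p + 1 : ℕ∞) : WithBot ℕ∞)) {q : Ideal R}
    (hq : q.IsPrime) (hpq : p.asIdeal < q) : q.IsMaximal := by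
  obtain ⟨m, hm, hqm⟩ := Ideal.exists_le_maximal q hq.ne_top
  rcases hqm.eq_or_lt with rfl | hqm
  · exact hm
  exfalso
  have hp_lt : p < ⟨q, hq⟩ := hpq
  have hq_lt : (⟨q, hq⟩ : PrimeSpectrum R) < ⟨m, hm.isPrime⟩ := hqm
  have hle : Order.height p + 1 + 1 ≤ Order.height p + 1 :=
    (add_le_add_left (Order.height_add_one_le hp_lt) 1).trans <|
      (Order.height_add_one_le hq_lt).trans <|
      WithBot.coe_le_coe.1 ((Order.height_le_krullDim _).trans hht)
  have htop : Order.height p ≠ ⊤ := fun h ↦ hfin <| top_le_iff.1 <| by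
    have h' : ((Order.height p : ℕ∞) : WithBot ℕ∞) ≤ ringKrullDim R := Order.height_le_krullDim p
    rwa [h] at h'
  have htop' : Order.height p + 1 ≠ ⊤ := by simpa using htop
  exact absurd ((ENat.add_one_le_iff htop').1 hle) (lt_irrefl _)

theorem KE_eq_modAss_of_height_ge_dim_sub_one (R : Type u) [CommRing R]
    [IsNoetherianRing R] (hfin : ringKrullDim R ≠ ⊤)
    (p : Ideal R) (hp : p.IsPrime)
    (hht : ringKrullDim R ≤
      ((Order.height (⟨p, hp⟩ : PrimeSpectrum R) + 1 : ℕ∞) : WithBot ℕ∞))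
    (X : ModuleCat.{u} R → Prop) (hX : MIsKEClosed R X)
    (hAss : AssOf R X = {p}) :
    ∀ M : ModuleCat.{u} R, X M ↔ modAss R {p} M := by
  obtain ⟨hfg, hadd, -⟩ := id hX
  have hmax (q : Ideal R) (hq : q.IsPrime) (hpq : p < q) : q.IsMaximal :=
    isMaximal_of_ringKrullDim_le_height_add_one hfin hht hq hpq
  have hsub (B : ModuleCat.{u} R) (hB : X B) : associatedPrimes R B ⊆ {p} :=
    fun q hq ↦ hAss ▸ ⟨B, hB, hq⟩
  refine fun M ↦ ⟨fun hM ↦ ⟨hfg M hM, hsub M hM⟩, fun ⟨_, hM⟩ ↦ ?_⟩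
  obtain ⟨B, hB, hpB⟩ : p ∈ AssOf R X := hAss ▸ rfl
  have := hfg B hB
  obtain ⟨f, hf⟩ := exists_injective_of_mem_associatedPrimes hpB
  refine hX.of_associatedPrimes_subset hmax hsub ?_ hM
  exact hadd.of_equiv (LinearEquiv.ofInjective f hf).symm
    (hX.submodule hmax (hsub B hB) hB (LinearMap.range f))
end

section
/- Let R be a commutative noetherian ring and X an extension-closed subcategory of mod R, and set Φ := Ass X. Then the following are equivalent: (i) X is a torsion-free class of mod R; (ii) X = mod^ass_Φ R; (iii) X ⊇ mod^ass_Φ R; (iv) X ⊇ mod^ass_{p} R for every p ∈ Φ. -/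
/-! Statement 12: Let `R` be a commutative noetherian ring and `X` an
extension-closed (additive) subcategory of `mod R`, and set `Φ := Ass X`.
TFAE: (i) `X` is a torsion-free class of `mod R`; (ii) `X = mod^ass_Φ R`;
(iii) `X ⊇ mod^ass_Φ R`; (iv) `X ⊇ mod^ass_{p} R` for every `p ∈ Φ`. -/

open CategoryTheory

universe u

open Submodule in
/-- If `T` is the submodule of elements killed by `I`, then `M ⧸ T` has no associated primes
beyond those of `M`. -/
theorem associatedPrimes_quotient_torsionBySet_subset {R M : Type*} [CommRing R]
    [IsNoetherianRing R] [AddCommGroup M] [Module R M] (I : Ideal R) :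
    associatedPrimes R (M ⧸ torsionBySet R M (I : Set R)) ⊆ associatedPrimes R M := by
  intro q hq
  rw [AssociatedPrimes.mem_iff, isAssociatedPrime_iff] at hq ⊢
  obtain ⟨hq, y, hy⟩ := hq
  obtain ⟨x, rfl⟩ := mkQ_surjective _ y
  obtain ⟨s, hs⟩ := IsNoetherian.noetherian I
  have key : q = s.inf fun a => (⊥ : Submodule R M).colon {a • x} := by
    rw [hy]
    ext r
    rw [mem_colon_singleton, mem_bot, ← map_smul, mkQ_apply, Quotient.mk_eq_zero, ← hs,
      Ideal.submodule_span_eq, ← torsionBySet_eq_torsionBySet_span, mem_torsionBySet_iff]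
    simp only [mem_finsetInf, mem_colon_singleton, mem_bot, Subtype.forall, Finset.mem_coe]
    exact forall₂_congr fun a _ => by rw [smul_comm]
  obtain ⟨a, -, ha⟩ := Ideal.eq_inf_of_isPrime_inf (key ▸ hq)
  exact ⟨hq, a • x, key.trans ha.symm⟩

/-- A finitely generated torsion-free module over a domain embeds into a finite free module. -/
theorem exists_injective_pi_of_isTorsionFree (A N : Type*) [CommRing A] [IsDomain A]
    [AddCommGroup N] [Module A N] [Module.Finite A N] [Module.IsTorsionFree A N] :
    ∃ (n : ℕ) (f : N →ₗ[A] (Fin n → A)), Function.Injective f := by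
  obtain ⟨m, s, hs⟩ := Module.Finite.exists_fin (R := A) (M := N)
  obtain ⟨I, hI, hmax⟩ := exists_maximal_linearIndepOn A s
  have hmul (i : Fin m) : ∃ a : A, a ≠ 0 ∧ a • s i ∈ Submodule.span A (s '' I) := by
    by_cases hi : i ∈ I
    · exact ⟨1, one_ne_zero, by
        rw [one_smul]; exact Submodule.subset_span (Set.mem_image_of_mem s hi)⟩
    · exact hmax i hi
  choose a ha ha' using hmul
  have hprod : ∏ i, a i ≠ 0 := Finset.prod_ne_zero_iff.2 fun i _ => ha i
  have hrange (x : N) : (∏ i, a i) • x ∈ Submodule.span A (s '' I) := by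
    have hx : x ∈ Submodule.span A (Set.range s) := hs ▸ Submodule.mem_top
    induction hx using Submodule.span_induction with
    | mem x hx =>
      obtain ⟨i, rfl⟩ := hx
      rw [Fintype.prod_eq_prod_compl_mul i, mul_smul]
      exact Submodule.smul_mem _ _ (ha' i)
    | zero => simp
    | add x y _ _ hx hy => rw [smul_add]; exact add_mem hx hy
    | smul c x _ hx => rw [smul_comm]; exact Submodule.smul_mem _ _ hx
  rw [Set.image_eq_range] at hrange
  let e := (Module.Basis.span hI).equivFun.trans
    (LinearEquiv.funCongrLeft A A (Finite.equivFin I).symm)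
  refine ⟨Nat.card I, e.toLinearMap ∘ₗ (LinearMap.lsmul A N (∏ i, a i)).codRestrict _ hrange, ?_⟩
  refine e.injective.comp fun x y hxy => ?_
  exact LinearMap.lsmul_injective hprod (congrArg Subtype.val hxy)

/-- A finitely generated module killed by `p` with `p` as its only possible associated prime
embeds into a finite power of `R ⧸ p`. -/
theorem exists_injective_pi_quotient_of_associatedPrimes_subset {R N : Type*} [CommRing R]
    [IsNoetherianRing R] [AddCommGroup N] [Module R N] [Module.Finite R N] {p : Ideal R}
    [p.IsPrime] (hp : Module.IsTorsionBySet R N (p : Set R))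
    (hass : associatedPrimes R N ⊆ {p}) :
    ∃ (n : ℕ) (f : N →ₗ[R] (Fin n → R ⧸ p)), Function.Injective f := by
  let _ : Module (R ⧸ p) N := hp.module
  have : IsScalarTower R (R ⧸ p) N := hp.isScalarTower
  have : Module.Finite (R ⧸ p) N := Module.Finite.of_restrictScalars_finite R _ _
  have : Module.IsTorsionFree (R ⧸ p) N := by
    rw [Module.isTorsionFree_iff_smul_eq_zero]
    intro r x hrx
    obtain ⟨r, rfl⟩ := Ideal.Quotient.mk_surjective r
    rw [or_iff_not_imp_right]
    intro hx
    obtain ⟨q, hq, hle⟩ := exists_le_isAssociatedPrime_of_isNoetherianRing R x hx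
    obtain rfl : q = p := hass hq
    refine Ideal.Quotient.eq_zero_iff_mem.2 (hle ?_)
    rwa [Submodule.mem_colon_singleton, Submodule.mem_bot]
  obtain ⟨n, f, hf⟩ := exists_injective_pi_of_isTorsionFree (R ⧸ p) N
  exact ⟨n, f.restrictScalars R, hf⟩

section

variable {R : Type u} [CommRing R] {X : ModuleCat.{u} R → Prop}

theorem MIsAdditive.of_equiv_s12 (hadd : MIsAdditive R X) {M N : Type u} [AddCommGroup M]
    [Module R M] [AddCommGroup N] [Module R N] (e : M ≃ₗ[R] N) (hM : X (ModuleCat.of R M)) :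
    X (ModuleCat.of R N) :=
  hadd.2.1 (ModuleCat.of R M) (ModuleCat.of R N) e hM

theorem MIsAdditive.fin_pi (hadd : MIsAdditive R X) {M : Type u} [AddCommGroup M]
    [Module R M] (hM : X (ModuleCat.of R M)) (n : ℕ) : X (ModuleCat.of R (Fin n → M)) := by
  induction n with
  | zero => exact hadd.1 _ (inferInstanceAs (Subsingleton (Fin 0 → M)))
  | succ n ih =>
    exact hadd.of_equiv_s12 (Fin.consLinearEquiv R fun _ : Fin (n + 1) => M) (hadd.2.2 _ _ hM ih)

theorem MClosedUnderSubmodules.of_injective (hsub : MClosedUnderSubmodules R X)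
    (hadd : MIsAdditive R X) {M N : Type u} [AddCommGroup M] [Module R M] [AddCommGroup N]
    [Module R N] (f : M →ₗ[R] N) (hf : Function.Injective f) (hN : X (ModuleCat.of R N)) :
    X (ModuleCat.of R M) :=
  hadd.of_equiv_s12 (LinearEquiv.ofInjective f hf).symm (hsub _ (LinearMap.range f) hN)

/-- An extension-closed subcategory contains `mod^ass_Φ R` as soon as it contains, for each
`p ∈ Φ`, the finitely generated modules killed by `p` with `p` as only associated prime. -/
theorem MClosedUnderExtensions.of_modAss [IsNoetherianRing R] (hadd : MIsAdditive R X)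
    (hext : MClosedUnderExtensions R X) {Φ : Set (Ideal R)}
    (h : ∀ p ∈ Φ, ∀ M : ModuleCat.{u} R, Module.IsTorsionBySet R M (p : Set R) →
      modAss R {p} M → X M) (M : ModuleCat.{u} R) (hM : modAss R Φ M) : X M := by
  obtain ⟨_, hM⟩ := hM
  suffices H : ∀ K : Submodule R M, associatedPrimes R (M ⧸ K) ⊆ Φ →
      X (ModuleCat.of R (M ⧸ K)) from
    hadd.of_equiv_s12 (Submodule.quotEquivOfEqBot ⊥ rfl)
      (H ⊥ ((LinearEquiv.AssociatedPrimes.eq (Submodule.quotEquivOfEqBot ⊥ rfl)).trans_subset hM))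
  intro K
  induction K using WellFoundedGT.induction with
  | ind K ih =>
  intro hK
  rcases subsingleton_or_nontrivial (M ⧸ K) with hs | hn
  · exact hadd.1 _ hs
  obtain ⟨p, hp, hmax⟩ := WellFounded.has_min (wellFounded_gt (α := Ideal R))
    (associatedPrimes R (M ⧸ K)) (associatedPrimes.nonempty R (M ⧸ K))
  let T := Submodule.torsionBySet R (M ⧸ K) (p : Set R)
  have hT : associatedPrimes R T ⊆ {p} := by
    intro q hq
    have hle : p ≤ q := by
      refine le_trans (fun r hr => Module.mem_annihilator.2 fun x => ?_)
        (IsAssociatedPrime.annihilator_le hq)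
      exact Subtype.ext (@Submodule.torsionBySet_isTorsionBySet R (M ⧸ K) _ _ _ p x ⟨r, hr⟩)
    exact (eq_of_le_of_not_lt hle
      (hmax q (associatedPrimes.subset_of_injective T.injective_subtype hq))).symm
  have hlt : K < T.comap K.mkQ := by
    obtain ⟨hprime, y, hy⟩ := isAssociatedPrime_iff.1 (AssociatedPrimes.mem_iff.1 hp)
    obtain ⟨x, rfl⟩ := K.mkQ_surjective y
    refine SetLike.lt_iff_le_and_exists.2 ⟨K.le_comap_mkQ T, x, ?_, fun hx => hprime.ne_top ?_⟩
    · refine (Submodule.mem_torsionBySet_iff _ _).2 fun ⟨r, hr⟩ => ?_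
      rwa [SetLike.mem_coe, hy, Submodule.mem_colon_singleton, Submodule.mem_bot] at hr
    · rw [hy, Submodule.mkQ_apply, (Submodule.Quotient.mk_eq_zero K).2 hx]
      simp
  let e : (M ⧸ T.comap K.mkQ) ≃ₗ[R] ((M ⧸ K) ⧸ T) :=
    (Submodule.quotEquivOfEq _ _ (by rw [LinearMap.ker_comp, Submodule.ker_mkQ])).trans
      ((T.mkQ ∘ₗ K.mkQ).quotKerEquivOfSurjective
        (T.mkQ_surjective.comp K.mkQ_surjective))
  refine hext (ModuleCat.of R (M ⧸ K)) T
    (h p (hK hp) _ (Submodule.torsionBySet_isTorsionBySet _) ⟨inferInstance, hT⟩)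
    (hadd.of_equiv_s12 e (ih _ hlt ?_))
  rw [LinearEquiv.AssociatedPrimes.eq e]
  exact (associatedPrimes_quotient_torsionBySet_subset p).trans hK

end

theorem extClosed_torsionFree_tfae (R : Type u) [CommRing R]
    [IsNoetherianRing R] (X : ModuleCat.{u} R → Prop)
    (hfg : IsSubcatOfFGMod R X) (hadd : MIsAdditive R X)
    (hext : MClosedUnderExtensions R X) :
    List.TFAE
      [ MIsTorsionFreeClass R X,
        ∀ M : ModuleCat.{u} R, X M ↔ modAss R (AssOf R X) M,
        ∀ M : ModuleCat.{u} R, modAss R (AssOf R X) M → X M,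
        ∀ p ∈ AssOf R X, ∀ M : ModuleCat.{u} R, modAss R {p} M → X M ] := by
  tfae_have 1 → 4 := by
    rintro ⟨-, -, hsub, -⟩ p ⟨L, hL, hp⟩
    obtain ⟨_, g, hg⟩ := (isAssociatedPrime_iff_exists_injective_linearMap p L).1 hp
    refine MClosedUnderExtensions.of_modAss hadd hext ?_
    rintro q rfl M htors ⟨_, hass⟩
    obtain ⟨n, f, hf⟩ := exists_injective_pi_quotient_of_associatedPrimes_subset htors hass
    exact hsub.of_injective hadd f hf (hadd.fin_pi (hsub.of_injective hadd g hg hL) n)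
  tfae_have 4 → 3 := fun h =>
    MClosedUnderExtensions.of_modAss hadd hext fun p hp M _ hM => h p hp M hM
  tfae_have 3 → 2 := fun h M =>
    ⟨fun hM => ⟨hfg M hM, fun _ hp => ⟨M, hM, hp⟩⟩, h M⟩
  tfae_have 2 → 1 := by
    refine fun h => ⟨hfg, hadd, fun M N hM => (h _).2 ?_, hext⟩
    have := hfg M hM
    exact ⟨inferInstanceAs (Module.Finite R N),
      (associatedPrimes.subset_of_injective N.injective_subtype).trans ((h M).1 hM).2⟩
  tfae_finish
end
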